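/- Let f : 2^N → ℝ be submodular and F its multilinear extension. Then for all y, z ∈ [0,1]^N and any u ∈ N, if y ≤ z coordinate-wise, the partial derivative satisfies ∂F/∂x_u(y) ≥ ∂F/∂x_u(z). -/

import Mathlib

/-- The multilinear extension of a set function `f`. -/
noncomputable def multilinearExt {N : Type*} [Fintype N] [DecidableEq N]
    (f : Finset N → ℝ) (x : N → ℝ) : ℝ :=
  ∑ S : Finset N, f S * (∏ u ∈ S, x u) * (∏ u ∈ Sᶜ, (1 - x u))

theorem sum_split_aux {N : Type*} [Fintype N] [DecidableEq N] (h : Finset N → ℝ) (i : N) :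
    ∑ S : Finset N, h S = ∑ S ∈ (Finset.univ.erase i).powerset, (h S + h (insert i S)) := by
  rw [Finset.sum_add_distrib, ← Finset.sum_powerset_insert (Finset.notMem_erase i _),
    Finset.insert_erase (Finset.mem_univ i), Finset.powerset_univ]

theorem ext_update_aux {N : Type*} [Fintype N] [DecidableEq N] (f : Finset N → ℝ)
    (x : N → ℝ) (i : N) (t : ℝ) :
    multilinearExt f (Function.update x i t) =
      t * multilinearExt (fun S => f (insert i S)) x
        + (1 - t) * multilinearExt (fun S => f (S.erase i)) x := by
  unfold multilinearExt
  rw [sum_split_aux _ i, sum_split_aux _ i, sum_split_aux _ i, Finset.mul_sum, Finset.mul_sum,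
    ← Finset.sum_add_distrib]
  refine Finset.sum_congr rfl fun S hS => ?_
  have hi : i ∉ S := fun h => by
    have := Finset.mem_powerset.1 hS h
    simp at this
  have hc : Sᶜ = insert i (insert i S)ᶜ := by
    ext a; by_cases h : a = i <;> simp [h, hi]
  have hi' : i ∉ (insert i S)ᶜ := by simp
  have e1 : ∏ u ∈ S, Function.update x i t u = ∏ u ∈ S, x u :=
    Finset.prod_congr rfl fun a ha => by
      rw [Function.update_of_ne (ne_of_mem_of_not_mem ha hi)]
  have e2 : ∏ u ∈ (insert i S)ᶜ, (1 - Function.update x i t u)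
      = ∏ u ∈ (insert i S)ᶜ, (1 - x u) :=
    Finset.prod_congr rfl fun a ha => by
      rw [Function.update_of_ne (ne_of_mem_of_not_mem ha hi')]
  rw [hc, Finset.prod_insert hi', Finset.prod_insert hi', Finset.prod_insert hi,
    Finset.prod_insert hi, e1, e2]
  beta_reduce
  rw [Finset.insert_idem, Finset.erase_insert hi,
    Finset.erase_eq_of_notMem hi, Function.update_self]
  ring

theorem ext_mono_fun_aux {N : Type*} [Fintype N] [DecidableEq N] (f g : Finset N → ℝ)
    (hfg : ∀ S, f S ≤ g S) (x : N → ℝ) (hx : ∀ i, x i ∈ Set.Icc (0 : ℝ) 1) :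
    multilinearExt f x ≤ multilinearExt g x := by
  unfold multilinearExt
  refine Finset.sum_le_sum fun S _ => ?_
  have h1 : 0 ≤ ∏ u ∈ S, x u := Finset.prod_nonneg fun i _ => (hx i).1
  have h2 : 0 ≤ ∏ u ∈ Sᶜ, (1 - x u) := Finset.prod_nonneg fun i _ => sub_nonneg.2 (hx i).2
  have := hfg S
  gcongr

theorem ext_anti_aux {N : Type*} [Fintype N] [DecidableEq N] (g : Finset N → ℝ)
    (hg : ∀ S T, S ⊆ T → g T ≤ g S) (y z : N → ℝ)
    (hy : ∀ i, y i ∈ Set.Icc (0 : ℝ) 1) (hz : ∀ i, z i ∈ Set.Icc (0 : ℝ) 1)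
    (hyz : y ≤ z) (A : Finset N) :
    multilinearExt g (A.piecewise z y) ≤ multilinearExt g y := by
  induction A using Finset.induction_on with
  | empty => simp
  | insert i A hi ih =>
    refine le_trans ?_ ih
    have hw : ∀ j, (A.piecewise z y) j ∈ Set.Icc (0 : ℝ) 1 := fun j => by
      by_cases h : j ∈ A <;> simp only [Finset.piecewise, h, if_true, if_false]
      · exact hz j
      · exact hy j
    have h1 : A.piecewise z y = Function.update (A.piecewise z y) i (y i) := by
      rw [← Finset.piecewise_eq_of_notMem A z y hi, Function.update_eq_self]
    rw [Finset.piecewise_insert]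
    conv_rhs => rw [h1]
    rw [ext_update_aux, ext_update_aux]
    have h2 := ext_mono_fun_aux (fun S => g (insert i S)) (fun S => g (S.erase i))
      (fun S => hg _ _ ((Finset.erase_subset i S).trans (Finset.subset_insert i S))) _ hw
    nlinarith [mul_nonneg (sub_nonneg.2 (hyz i)) (sub_nonneg.2 h2)]

theorem stmt9 {N : Type*} [Fintype N] [DecidableEq N] (f : Finset N → ℝ)
    (hsub : ∀ S T : Finset N, f (S ∪ T) + f (S ∩ T) ≤ f S + f T)
    (y z : N → ℝ)
    (hy : ∀ i, y i ∈ Set.Icc (0 : ℝ) 1)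
    (hz : ∀ i, z i ∈ Set.Icc (0 : ℝ) 1)
    (hyz : y ≤ z) (u : N) :
    multilinearExt f (Function.update z u 1) - multilinearExt f (Function.update z u 0)
      ≤ multilinearExt f (Function.update y u 1) - multilinearExt f (Function.update y u 0) := by
  have key : ∀ x : N → ℝ,
      multilinearExt f (Function.update x u 1) - multilinearExt f (Function.update x u 0)
        = multilinearExt (fun S => f (insert u S) - f (S.erase u)) x := fun x => by
    rw [ext_update_aux, ext_update_aux]
    simp only [multilinearExt, sub_mul, Finset.sum_sub_distrib]
    ring
  rw [key, key]
  have := ext_anti_aux (fun S => f (insert u S) - f (S.erase u)) ?_ y z hy hz hyz Finset.univ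
  · simpa using this
  · intro S T hST
    have h := hsub (insert u S) (T.erase u)
    have e1 : insert u S ∪ T.erase u = insert u T := by
      ext a
      have := @hST a
      by_cases h : a = u <;> simp [h]
      exact this
    have e2 : insert u S ∩ T.erase u = S.erase u := by
      ext a
      have := @hST a
      by_cases h : a = u <;> simp [h]
      exact this
    rw [e1, e2] at h
    linarith
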